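/- arXiv:1908.11499 — 2 statements merged into one kernel-verified Lean document; each statement's English description precedes it below -/
import Mathlib

section
/- Let t1 < t2 be real numbers, let x, K : [t1,t2] → ℝ be continuous with K nonnegative, and let A, B : [t1,t2] → ℝ be integrable on [t1,t2] with B nonnegative. If x(t) ≤ A(t) + B(t)·∫_{t1}^{t} K(s)·x(s) ds for every t ∈ [t1,t2], then x(t) ≤ A(t) + B(t)·∫_{t1}^{t} A(s)·K(s)·exp(∫_{s}^{t} B(r)·K(r) dr) ds for every t ∈ [t1,t2]. -/
open MeasureTheory intervalIntegral

theorem LipschitzOnWith.comp_absolutelyContinuousOnInterval {X Y : Type*}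
    [PseudoMetricSpace X] [PseudoMetricSpace Y] {φ : X → Y} {f : ℝ → X} {C : NNReal} {s : Set X}
    {a b : ℝ} (hφ : LipschitzOnWith C φ s) (hf : AbsolutelyContinuousOnInterval f a b)
    (hs : Set.MapsTo f (Set.uIcc a b) s) :
    AbsolutelyContinuousOnInterval (fun t => φ (f t)) a b := by
  rw [absolutelyContinuousOnInterval_iff] at hf ⊢
  intro ε hε
  obtain ⟨δ, hδ, h⟩ := hf (ε / (C + 1)) (by positivity)
  refine ⟨δ, hδ, fun E hE hlen => ?_⟩
  calc
    _ ≤ ∑ i ∈ Finset.range E.1, C * dist (f (E.2 i).1) (f (E.2 i).2) :=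
      Finset.sum_le_sum fun i hi =>
        hφ.dist_le_mul _ (hs (hE.1 i hi).1) _ (hs (hE.1 i hi).2)
    _ = C * ∑ i ∈ Finset.range E.1, dist (f (E.2 i).1) (f (E.2 i).2) :=
      (Finset.mul_sum _ _ _).symm
    _ ≤ C * (ε / (C + 1)) := by gcongr; exact (h E hE hlen).le
    _ < (C + 1) * (ε / (C + 1)) := by gcongr; linarith
    _ = ε := by field

theorem AbsolutelyContinuousOnInterval.rexp {f : ℝ → ℝ} {a b : ℝ}
    (hf : AbsolutelyContinuousOnInterval f a b) :
    AbsolutelyContinuousOnInterval (fun t => Real.exp (f t)) a b := by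
  obtain ⟨M, hM⟩ := hf.exists_bound
  obtain ⟨C, hC⟩ := (Real.contDiff_exp (n := 1)).contDiffOn.exists_lipschitzOnWith (by decide)
    (convex_Icc (-M) M) isCompact_Icc
  exact hC.comp_absolutelyContinuousOnInterval hf fun t ht => abs_le.mp (hM t ht)

/-- An absolutely continuous solution of the linear differential inequality `u' ≤ α + β u` is
bounded by the variation of constants formula. -/
theorem AbsolutelyContinuousOnInterval.le_of_deriv_le_add_mul {u α β : ℝ → ℝ} {a b : ℝ}
    (hab : a ≤ b) (hu : AbsolutelyContinuousOnInterval u a b)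
    (hα : IntervalIntegrable α volume a b) (hβ : IntervalIntegrable β volume a b)
    (h : ∀ᵐ t, t ∈ Set.Icc a b → deriv u t ≤ α t + β t * u t) :
    u b ≤ u a * Real.exp (∫ r in a..b, β r) + ∫ s in a..b, α s * Real.exp (∫ r in s..b, β r) := by
  set g : ℝ → ℝ := fun s => Real.exp (∫ r in s..b, β r) with hg_def
  have hsymm : (fun s => ∫ r in s..b, β r) = fun s => -∫ r in b..s, β r :=
    funext fun s => integral_symm _ _
  have hg : AbsolutelyContinuousOnInterval g a b := by
    refine AbsolutelyContinuousOnInterval.rexp ?_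
    rw [hsymm]
    exact (hβ.absolutelyContinuousOnInterval_intervalIntegral Set.right_mem_uIcc).fun_neg
  have hparts := hu.integral_deriv_mul_eq_sub hg
  have hmono : ∫ t in a..b, deriv u t * g t + u t * deriv g t ≤ ∫ t in a..b, α t * g t := by
    refine integral_mono_ae_restrict hab
      ((hu.intervalIntegrable_deriv.mul_continuousOn hg.continuousOn).add
        (hg.intervalIntegrable_deriv.continuousOn_mul hu.continuousOn))
      (hα.mul_continuousOn hg.continuousOn) ?_
    refine (ae_restrict_iff' measurableSet_Icc).mpr ?_
    filter_upwards [h, hβ.ae_hasDerivAt_integral] with t hut hβt ht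
    have hd : HasDerivAt (fun s => ∫ r in s..b, β r) (-β t) t := by
      rw [hsymm]
      exact (hβt (Set.uIcc_of_le hab ▸ ht) b Set.right_mem_uIcc).neg
    have hgd : deriv g t = g t * -β t := hd.exp.deriv
    have hpos : 0 < g t := Real.exp_pos _
    rw [hgd]
    nlinarith [mul_le_mul_of_nonneg_right (hut ht) hpos.le]
  have hgb : g b = 1 := by simp [hg_def]
  rw [hparts, hgb, mul_one] at hmono
  linarith

/-- Gronwall-type integral inequality (Dragomir). -/
theorem gronwall_type_inequality
    (t1 t2 : ℝ) (ht : t1 < t2) (x K A B : ℝ → ℝ)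
    (hx : ContinuousOn x (Set.Icc t1 t2))
    (hK : ContinuousOn K (Set.Icc t1 t2))
    (hKnn : ∀ t ∈ Set.Icc t1 t2, 0 ≤ K t)
    (hA : IntervalIntegrable A volume t1 t2)
    (hB : IntervalIntegrable B volume t1 t2)
    (hBnn : ∀ t ∈ Set.Icc t1 t2, 0 ≤ B t)
    (hineq : ∀ t ∈ Set.Icc t1 t2, x t ≤ A t + B t * ∫ s in t1..t, K s * x s) :
    ∀ t ∈ Set.Icc t1 t2,
      x t ≤ A t + B t * ∫ s in t1..t,
        A s * K s * Real.exp (∫ r in s..t, B r * K r) := by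
  intro t htI
  have hsub : Set.Icc t1 t ⊆ Set.Icc t1 t2 := Set.Icc_subset_Icc_right htI.2
  have hsub' : Set.uIcc t1 t ⊆ Set.uIcc t1 t2 := by
    rwa [Set.uIcc_of_le htI.1, Set.uIcc_of_le ht.le]
  have hKt : ContinuousOn K (Set.uIcc t1 t) := by
    rw [Set.uIcc_of_le htI.1]
    exact hK.mono hsub
  have hxt : ContinuousOn x (Set.uIcc t1 t) := by
    rw [Set.uIcc_of_le htI.1]
    exact hx.mono hsub
  have hKx : IntervalIntegrable (fun s => K s * x s) volume t1 t :=
    (hKt.mul hxt).intervalIntegrable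
  have hu := AbsolutelyContinuousOnInterval.le_of_deriv_le_add_mul htI.1
    (hKx.absolutelyContinuousOnInterval_intervalIntegral Set.left_mem_uIcc)
    ((hA.mono_set hsub').mul_continuousOn hKt) ((hB.mono_set hsub').mul_continuousOn hKt) (by
      filter_upwards [hKx.ae_hasDerivAt_integral] with s hs hsI
      rw [(hs (Set.uIcc_of_le htI.1 ▸ hsI) t1 Set.left_mem_uIcc).deriv]
      nlinarith [mul_le_mul_of_nonneg_left (hineq s (hsub hsI)) (hKnn s (hsub hsI))])
  rw [integral_same, zero_mul, zero_add] at hu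
  exact (hineq t htI).trans (by gcongr; exact hBnn t htI)
end

section
/- Let D : [0,∞) → ℝ^{l×l} be C¹ with each D(t) symmetric, let α : [0,∞) → ℝ, let f, g_1, …, g_m : [0,∞) × ℝ^l → ℝ^l be C¹ in the space variable with Jacobians Jac_f(t,x) and Jac_{g_i}(t,x) continuous in x. Suppose for all t ≥ 0, all x, y ∈ ℝ^l, and all v ∈ ℝ^l with v ≠ 0: vᵀ·( D'(t) + 2·Jac_f(t,x)ᵀ·D(t) + Σ_{i=1}^{m} Jac_{g_i}(t,x)ᵀ·D(t)·Jac_{g_i}(t,y) )·v < α(t)·vᵀ·D(t)·v. Then for all t ≥ 0 and all x, y ∈ ℝ^l with x ≠ y, setting Δ = x − y: Δᵀ·D'(t)·Δ + 2·(f(t,x) − f(t,y))ᵀ·D(t)·Δ + Σ_{i=1}^{m} (g_i(t,x) − g_i(t,y))ᵀ·D(t)·(g_i(t,x) − g_i(t,y)) < α(t)·Δᵀ·D(t)·Δ. -/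
open Matrix

/-- An upper bound on the derivative on all of `ℝ` bounds the increment over `[0, 1]` strictly. -/
theorem sub_lt_of_forall_hasDerivAt_lt {F F' : ℝ → ℝ} {c : ℝ}
    (hF : ∀ s, HasDerivAt F (F' s) s) (hlt : ∀ s, F' s < c) : F 1 - F 0 < c := by
  obtain ⟨s, -, hs⟩ := exists_hasDerivAt_eq_slope F F' zero_lt_one
    (fun s _ => (hF s).continuousAt.continuousWithinAt) (fun s _ => hF s)
  have := hlt s
  rw [hs] at this
  simpa using this

/-- The derivative of `s ↦ h (y + s • v) ⬝ᵥ w` in terms of the Jacobian matrix of `h`. -/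
theorem hasDerivAt_lineMap_dotProduct {m n : Type*} [Fintype m] [Fintype n] [DecidableEq n]
    {h : (n → ℝ) → (m → ℝ)} {J : (n → ℝ) → Matrix m n ℝ}
    (hJ : ∀ x, HasFDerivAt h (LinearMap.toContinuousLinearMap (Matrix.mulVecLin (J x))) x)
    (y v : n → ℝ) (w : m → ℝ) (s : ℝ) :
    HasDerivAt (fun s : ℝ => h (y + s • v) ⬝ᵥ w) ((J (y + s • v) *ᵥ v) ⬝ᵥ w) s := by
  have hline : HasDerivAt (fun s : ℝ => y + s • v) v s := by
    simpa using ((hasDerivAt_id s).smul_const v).const_add y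
  have hcomp := (hJ (y + s • v)).comp_hasDerivAt s hline
  have hcoord := hasDerivAt_pi.1 hcomp
  exact HasDerivAt.fun_sum fun i _ => (hcoord i).mul_const (w i)

/-- A quadratic form of the shape `AᵀDB`, written as a bilinear pairing. -/
theorem dotProduct_transpose_mul_mul_mulVec {m n : Type*} [Fintype m] [Fintype n]
    (A B : Matrix m n ℝ) (D : Matrix m m ℝ) (v : n → ℝ) :
    v ⬝ᵥ ((Aᵀ * D * B) *ᵥ v) = (A *ᵥ v) ⬝ᵥ (D *ᵥ (B *ᵥ v)) := by
  rw [← mulVec_mulVec, ← mulVec_mulVec, dotProduct_mulVec, vecMul_transpose]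

/-- Mean-value-theorem estimate from the proof of Theorem 4.3 of the paper: a strict
matrix inequality on the Jacobians transfers to the corresponding quadratic form in
finite differences. -/
theorem generator_estimate_of_jacobian_inequality (l m : ℕ)
    (D D' : ℝ → Matrix (Fin l) (Fin l) ℝ)
    (hD : ∀ t i j, HasDerivAt (fun s => D s i j) (D' t i j) t)
    (hDsymm : ∀ t, (D t)ᵀ = D t)
    (α : ℝ → ℝ)
    (f : ℝ → (Fin l → ℝ) → (Fin l → ℝ))
    (g : Fin m → ℝ → (Fin l → ℝ) → (Fin l → ℝ))
    (Jf : ℝ → (Fin l → ℝ) → Matrix (Fin l) (Fin l) ℝ)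
    (Jg : Fin m → ℝ → (Fin l → ℝ) → Matrix (Fin l) (Fin l) ℝ)
    (hJf : ∀ t x, HasFDerivAt (f t)
      (LinearMap.toContinuousLinearMap (Matrix.mulVecLin (Jf t x))) x)
    (hJg : ∀ i t x, HasFDerivAt (g i t)
      (LinearMap.toContinuousLinearMap (Matrix.mulVecLin (Jg i t x))) x)
    (hJfc : ∀ t i j, Continuous fun x => Jf t x i j)
    (hJgc : ∀ k t i j, Continuous fun x => Jg k t x i j)
    (hyp : ∀ t, 0 ≤ t → ∀ x y v : Fin l → ℝ, v ≠ 0 →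
      v ⬝ᵥ ((D' t + (2 : ℝ) • ((Jf t x)ᵀ * D t)
          + ∑ i, (Jg i t x)ᵀ * D t * (Jg i t y)).mulVec v)
        < α t * (v ⬝ᵥ ((D t).mulVec v))) :
    ∀ t, 0 ≤ t → ∀ x y : Fin l → ℝ, x ≠ y →
      (x - y) ⬝ᵥ ((D' t).mulVec (x - y))
        + 2 * ((f t x - f t y) ⬝ᵥ ((D t).mulVec (x - y)))
        + ∑ i, (g i t x - g i t y) ⬝ᵥ ((D t).mulVec (g i t x - g i t y))
        < α t * ((x - y) ⬝ᵥ ((D t).mulVec (x - y))) := by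
  intro t ht x y hxy
  set v := x - y with hv
  have hv0 : v ≠ 0 := sub_ne_zero.2 hxy
  have hx : y + (1 : ℝ) • v = x := by simp [hv]
  have hy : y + (0 : ℝ) • v = y := by simp
  have hyp' : ∀ s r : ℝ,
      2 * ((Jf t (y + s • v) *ᵥ v) ⬝ᵥ (D t *ᵥ v))
        + ∑ i, (Jg i t (y + s • v) *ᵥ v) ⬝ᵥ (D t *ᵥ (Jg i t (y + r • v) *ᵥ v))
        < α t * (v ⬝ᵥ (D t *ᵥ v)) - v ⬝ᵥ (D' t *ᵥ v) := by
    intro s r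
    have h := hyp t ht (y + s • v) (y + r • v) v hv0
    simp only [add_mulVec, sum_mulVec, smul_mulVec, dotProduct_add, dotProduct_sum,
      dotProduct_smul, dotProduct_transpose_mul_mul_mulVec, smul_eq_mul] at h
    rw [← mulVec_mulVec, dotProduct_mulVec v (Jf t (y + s • v))ᵀ, vecMul_transpose] at h
    linarith
  have hfirst : ∀ r : ℝ,
      ∑ i, (g i t x - g i t y) ⬝ᵥ (D t *ᵥ (Jg i t (y + r • v) *ᵥ v))
        < α t * (v ⬝ᵥ (D t *ᵥ v)) - v ⬝ᵥ (D' t *ᵥ v)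
          - 2 * ((f t x - f t y) ⬝ᵥ (D t *ᵥ v)) := by
    intro r
    have h := sub_lt_of_forall_hasDerivAt_lt (fun s =>
      ((hasDerivAt_lineMap_dotProduct (hJf t) y v (D t *ᵥ v) s).const_mul 2).fun_add
        (HasDerivAt.fun_sum (u := Finset.univ) fun i _ => hasDerivAt_lineMap_dotProduct (hJg i t) y v
          (D t *ᵥ (Jg i t (y + r • v) *ᵥ v)) s)) (fun s => hyp' s r)
    simp only [hx, hy] at h
    simp only [sub_dotProduct, Finset.sum_sub_distrib]
    linarith
  have hpair : ∀ a b : Fin l → ℝ, a ⬝ᵥ (D t *ᵥ b) = b ⬝ᵥ (D t *ᵥ a) := by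
    intro a b
    rw [dotProduct_mulVec, ← mulVec_transpose, hDsymm, dotProduct_comm]
  simp only [hpair (g _ t x - g _ t y)] at hfirst
  have h := sub_lt_of_forall_hasDerivAt_lt (fun r =>
    HasDerivAt.fun_sum (u := Finset.univ) fun i _ => hasDerivAt_lineMap_dotProduct (hJg i t) y v
      (D t *ᵥ (g i t x - g i t y)) r) hfirst
  simp only [hx, hy, ← Finset.sum_sub_distrib, ← sub_dotProduct] at h
  linarith
end
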